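/- There exist δ₀ > 0 and C > 0, depending only on p, μ, v_±, s and the profile ṽ, such that for every T > 0, every δ ≤ δ₀, and every classical solution (Φ,Ψ) of the integrated perturbation system on ℝ × [0,T] satisfying the a priori smallness assumption with parameter δ, for all t ∈ [0,T]: ∫_ℝ (Φ² + Ψ²)(ξ,t) dξ − s ∫₀ᵗ ∫_ℝ ∂_ξ(1/p'(ṽ)) Ψ² dξ dτ + ∫₀ᵗ ∫_ℝ Φ_ξ² dξ dτ ≤ C ‖(Φ₀,Ψ₀)‖² + C δ ∫₀ᵗ ∫_ℝ Φ_ξξ² dξ dτ. -/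

import Mathlib

open MeasureTheory Filter Topology Set

noncomputable section

noncomputable def L2sq (w : ℝ → ℝ) : ℝ := ∫ ξ : ℝ, (w ξ) ^ 2

noncomputable def HkSq (k : ℕ) (w : ℝ → ℝ) : ℝ :=
  ∑ j ∈ Finset.range (k + 1), L2sq (iteratedDeriv j w)

noncomputable def pairHkSq (k : ℕ) (F G : ℝ → ℝ) : ℝ := HkSq k F + HkSq k G

/-- The nonlinear remainder `G = (g'(v) - g'(ṽ))Φ_ξξ + (g'(v) - g'(ṽ) - g''(ṽ)Φ_ξ)ṽ_ξ`
with `v = ṽ + Φ_ξ`. -/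
noncomputable def Gterm (g tv φ : ℝ → ℝ) (ξ : ℝ) : ℝ :=
  (deriv g (tv ξ + deriv φ ξ) - deriv g (tv ξ)) * iteratedDeriv 2 φ ξ +
    (deriv g (tv ξ + deriv φ ξ) - deriv g (tv ξ)
      - deriv (deriv g) (tv ξ) * deriv φ ξ) * deriv tv ξ

/-- The relative pressure `p(v|ṽ) = p(v) - p(ṽ) - p'(ṽ)(v - ṽ)` with `v = ṽ + Φ_ξ`. -/
noncomputable def prel (p tv φ : ℝ → ℝ) (ξ : ℝ) : ℝ :=
  p (tv ξ + deriv φ ξ) - p (tv ξ) - deriv p (tv ξ) * deriv φ ξ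

/-- A classical solution of the integrated perturbation system on `ℝ × [0,T]`:
`C⁴` in `ξ`, `C¹` in `t` with continuous mixed derivatives `∂_t ∂_ξ^j` (`j ≤ 3`),
satisfying both equations pointwise, with square-integrable `ξ`-derivatives up to order 4
(`L²`-norms continuous in `t`) and derivatives up to order 3 decaying at spatial infinity,
uniformly in `t`. -/
structure IsClassicalSolution (p g tv : ℝ → ℝ) (s T : ℝ) (Φ Ψ : ℝ → ℝ → ℝ) : Prop where
  regΦ : ∀ t ∈ Set.Icc (0:ℝ) T, ContDiff ℝ 4 (Φ t)
  regΨ : ∀ t ∈ Set.Icc (0:ℝ) T, ContDiff ℝ 4 (Ψ t)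
  tdiffΦ : ∀ j : ℕ, j ≤ 3 → ∀ t ∈ Set.Icc (0:ℝ) T, ∀ ξ : ℝ,
    DifferentiableAt ℝ (fun τ => iteratedDeriv j (Φ τ) ξ) t
  tdiffΨ : ∀ j : ℕ, j ≤ 3 → ∀ t ∈ Set.Icc (0:ℝ) T, ∀ ξ : ℝ,
    DifferentiableAt ℝ (fun τ => iteratedDeriv j (Ψ τ) ξ) t
  mixContΦ : ∀ j : ℕ, j ≤ 3 → ContinuousOn
    (fun q : ℝ × ℝ => deriv (fun τ => iteratedDeriv j (Φ τ) q.2) q.1)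
    (Set.Icc (0:ℝ) T ×ˢ (Set.univ : Set ℝ))
  mixContΨ : ∀ j : ℕ, j ≤ 3 → ContinuousOn
    (fun q : ℝ × ℝ => deriv (fun τ => iteratedDeriv j (Ψ τ) q.2) q.1)
    (Set.Icc (0:ℝ) T ×ˢ (Set.univ : Set ℝ))
  spContΦ : ∀ j : ℕ, j ≤ 4 → ContinuousOn
    (fun q : ℝ × ℝ => iteratedDeriv j (Φ q.1) q.2)
    (Set.Icc (0:ℝ) T ×ˢ (Set.univ : Set ℝ))
  spContΨ : ∀ j : ℕ, j ≤ 4 → ContinuousOn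
    (fun q : ℝ × ℝ => iteratedDeriv j (Ψ q.1) q.2)
    (Set.Icc (0:ℝ) T ×ˢ (Set.univ : Set ℝ))
  eq1 : ∀ t ∈ Set.Icc (0:ℝ) T, ∀ ξ : ℝ,
    deriv (fun τ => Φ τ ξ) t - s * deriv (Φ t) ξ - deriv (Ψ t) ξ
        - deriv g (tv ξ) * iteratedDeriv 2 (Φ t) ξ
        - deriv (deriv g) (tv ξ) * deriv tv ξ * deriv (Φ t) ξ
      = Gterm g tv (Φ t) ξ
  eq2 : ∀ t ∈ Set.Icc (0:ℝ) T, ∀ ξ : ℝ,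
    deriv (fun τ => Ψ τ ξ) t - s * deriv (Ψ t) ξ + deriv p (tv ξ) * deriv (Φ t) ξ
      = -prel p tv (Φ t) ξ
  sqIntΦ : ∀ j : ℕ, j ≤ 4 → ∀ t ∈ Set.Icc (0:ℝ) T,
    MeasureTheory.Integrable (fun ξ : ℝ => (iteratedDeriv j (Φ t) ξ) ^ 2)
  sqIntΨ : ∀ j : ℕ, j ≤ 4 → ∀ t ∈ Set.Icc (0:ℝ) T,
    MeasureTheory.Integrable (fun ξ : ℝ => (iteratedDeriv j (Ψ t) ξ) ^ 2)
  l2ContΦ : ∀ j : ℕ, j ≤ 4 →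
    ContinuousOn (fun t => L2sq (iteratedDeriv j (Φ t))) (Set.Icc (0:ℝ) T)
  l2ContΨ : ∀ j : ℕ, j ≤ 4 →
    ContinuousOn (fun t => L2sq (iteratedDeriv j (Ψ t))) (Set.Icc (0:ℝ) T)
  decayΦ : ∀ j : ℕ, j ≤ 3 → ∀ ε > (0:ℝ), ∃ R : ℝ, ∀ t ∈ Set.Icc (0:ℝ) T, ∀ ξ : ℝ,
    R ≤ |ξ| → |iteratedDeriv j (Φ t) ξ| < ε
  decayΨ : ∀ j : ℕ, j ≤ 3 → ∀ ε > (0:ℝ), ∃ R : ℝ, ∀ t ∈ Set.Icc (0:ℝ) T, ∀ ξ : ℝ,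
    R ≤ |ξ| → |iteratedDeriv j (Ψ t) ξ| < ε

/-- Continuity of a parametric interval integral, for an integrand continuous on a strip. -/
lemma continuousOn_intervalIntegral_of_strip {F : ℝ → ℝ → ℝ} {t : ℝ} (ht : 0 ≤ t)
    (hF : ContinuousOn (Function.uncurry F) (Icc 0 t ×ˢ univ)) (a b : ℝ) :
    ContinuousOn (fun τ => ∫ ξ in a..b, F τ ξ) (Icc 0 t) := by
  have hc : Continuous (Function.uncurry fun (τ : ℝ) (ξ : ℝ) => F (projIcc 0 t ht τ) ξ) := by
    have : Continuous fun q : ℝ × ℝ => (((projIcc 0 t ht q.1 : Icc 0 t) : ℝ), q.2) := by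
      fun_prop
    exact hF.comp_continuous this fun q => ⟨(projIcc 0 t ht q.1).2, mem_univ _⟩
  have := intervalIntegral.continuous_parametric_intervalIntegral_of_continuous' hc a b
    (μ := volume)
  refine this.continuousOn.congr fun τ hτ => ?_
  simp only [projIcc_of_mem ht hτ]

lemma continuous_section_of_strip {F : ℝ → ℝ → ℝ} {t : ℝ}
    (hF : ContinuousOn (Function.uncurry F) (Icc 0 t ×ˢ univ)) {τ : ℝ} (hτ : τ ∈ Icc 0 t) :
    Continuous (F τ) :=
  hF.comp_continuous (f := fun ξ => (τ, ξ)) (by fun_prop) fun _ => ⟨hτ, mem_univ _⟩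

lemma intervalIntegrable_box_of_strip {F : ℝ → ℝ → ℝ} {t : ℝ} (ht : 0 ≤ t)
    (hF : ContinuousOn (Function.uncurry F) (Icc 0 t ×ˢ univ)) (a b : ℝ) :
    IntervalIntegrable (fun τ => ∫ ξ in a..b, F τ ξ) volume 0 t :=
  ContinuousOn.intervalIntegrable_of_Icc ht (continuousOn_intervalIntegral_of_strip ht hF a b)

/-- Truncated space integrals of a nonnegative function exhaust the full space-time integral. -/
lemma tendsto_box_integral {F u : ℝ → ℝ → ℝ} {t M : ℝ} (ht : 0 ≤ t)
    (hF : ContinuousOn (Function.uncurry F) (Icc 0 t ×ˢ univ))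
    (hF0 : ∀ τ ∈ Icc 0 t, ∀ ξ, 0 ≤ F τ ξ) (hFu : ∀ τ ∈ Icc 0 t, ∀ ξ, F τ ξ ≤ M * u τ ξ)
    (hu : ∀ τ ∈ Icc 0 t, Integrable (u τ))
    (huc : ContinuousOn (fun τ => ∫ ξ, u τ ξ) (Icc 0 t)) :
    Tendsto (fun R : ℝ => ∫ τ in (0:ℝ)..t, ∫ ξ in (-R)..R, F τ ξ) atTop
      (𝓝 (∫ τ in (0:ℝ)..t, ∫ ξ, F τ ξ)) := by
  have hsub : ∀ τ ∈ uIoc 0 t, τ ∈ Icc 0 t := fun τ hτ => by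
    rw [uIoc_of_le ht] at hτ
    exact ⟨hτ.1.le, hτ.2⟩
  have hint : ∀ τ ∈ Icc 0 t, Integrable (F τ) := fun τ hτ => by
    refine ((hu τ hτ).const_mul M).mono'
      (continuous_section_of_strip hF hτ).aestronglyMeasurable (ae_of_all _ fun ξ => ?_)
    rw [Real.norm_of_nonneg (hF0 τ hτ ξ)]
    exact hFu τ hτ ξ
  refine intervalIntegral.tendsto_integral_filter_of_dominated_convergence
    (fun τ => M * ∫ ξ, u τ ξ) (Eventually.of_forall fun R => ?_) ?_ ?_
    (ae_of_all _ fun τ hτ => ?_)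
  · exact (intervalIntegrable_iff.1 (intervalIntegrable_box_of_strip ht hF (-R) R)).1
  · filter_upwards [eventually_ge_atTop 0] with R hR
    refine ae_of_all _ fun τ hτ => ?_
    have h := hsub τ hτ
    rw [intervalIntegral.integral_of_le (by linarith), Real.norm_of_nonneg
      (integral_nonneg fun ξ => hF0 τ h ξ), ← integral_const_mul]
    exact (setIntegral_le_integral (hint τ h) (ae_of_all _ (hF0 τ h))).trans
      (integral_mono (hint τ h) ((hu τ h).const_mul M) (hFu τ h))
  · exact ContinuousOn.intervalIntegrable_of_Icc ht (huc.const_smul M)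
  · exact intervalIntegral_tendsto_integral (hint τ (hsub τ hτ)) tendsto_neg_atTop_atBot tendsto_id

/-- A pointwise energy inequality `∂ₜe ≤ ∂ₓB - Q` with a flux `B` vanishing at infinity,
integrated over a space-time strip. -/
lemma integral_add_le_of_pointwise {e et B Bx Q : ℝ → ℝ → ℝ} {t I : ℝ} (ht : 0 ≤ t)
    (het : ∀ τ ∈ Icc 0 t, ∀ ξ, HasDerivAt (fun τ => e τ ξ) (et τ ξ) τ)
    (hetc : ContinuousOn (Function.uncurry et) (Icc 0 t ×ˢ univ))
    (hB : ∀ τ ∈ Icc 0 t, ∀ ξ, HasDerivAt (B τ) (Bx τ ξ) ξ)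
    (hBc : ∀ τ ∈ Icc 0 t, Continuous (Bx τ))
    (hQ : ContinuousOn (Function.uncurry Q) (Icc 0 t ×ˢ univ))
    (hle : ∀ τ ∈ Icc 0 t, ∀ ξ, et τ ξ ≤ Bx τ ξ - Q τ ξ)
    (hdecay : ∀ ε > (0:ℝ), ∃ R : ℝ, ∀ τ ∈ Icc 0 t, ∀ ξ : ℝ, R ≤ |ξ| → |B τ ξ| < ε)
    (he : ∀ τ ∈ Icc 0 t, Integrable (e τ))
    (hI : Tendsto (fun R : ℝ => ∫ τ in (0:ℝ)..t, ∫ ξ in (-R)..R, Q τ ξ) atTop (𝓝 I)) :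
    (∫ ξ, e t ξ) + I ≤ ∫ ξ, e 0 ξ := by
  have hlim : ∀ τ ∈ Icc 0 t, Tendsto (fun R : ℝ => ∫ ξ in (-R)..R, e τ ξ) atTop
      (𝓝 (∫ ξ, e τ ξ)) := fun τ hτ =>
    intervalIntegral_tendsto_integral (he τ hτ) tendsto_neg_atTop_atBot tendsto_id
  have h0 : (0:ℝ) ∈ Icc 0 t := ⟨le_rfl, ht⟩
  have h1 : t ∈ Icc 0 t := ⟨ht, le_rfl⟩
  have hbox : ∀ ε > (0:ℝ), ∀ᶠ R : ℝ in atTop,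
      (∫ ξ in (-R)..R, e t ξ) + (∫ τ in (0:ℝ)..t, ∫ ξ in (-R)..R, Q τ ξ)
        ≤ (∫ ξ in (-R)..R, e 0 ξ) + t * (2 * ε) := by
    intro ε hε
    obtain ⟨R₀, hR₀⟩ := hdecay ε hε
    filter_upwards [eventually_ge_atTop R₀, eventually_ge_atTop 0] with R hR hR'
    have hfub : (∫ ξ in (-R)..R, e t ξ) - (∫ ξ in (-R)..R, e 0 ξ)
        = ∫ τ in (0:ℝ)..t, ∫ ξ in (-R)..R, et τ ξ := by
      have hsec : ∀ ξ, ∫ τ in (0:ℝ)..t, et τ ξ = e t ξ - e 0 ξ := fun ξ => by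
        refine intervalIntegral.integral_eq_sub_of_hasDerivAt (f := fun τ => e τ ξ)
          (fun τ hτ => ?_) ?_
        · rw [uIcc_of_le ht] at hτ
          exact het τ hτ ξ
        · refine ContinuousOn.intervalIntegrable_of_Icc ht ?_
          exact hetc.comp (f := fun τ => (τ, ξ)) (by fun_prop) fun τ hτ => ⟨hτ, mem_univ _⟩
      rw [intervalIntegral_intervalIntegral_swap, ← intervalIntegral.integral_sub
        (he t h1).intervalIntegrable (he 0 h0).intervalIntegrable]
      · exact intervalIntegral.integral_congr fun ξ _ => (hsec ξ).symm
      · rw [uIoc_of_le ht, uIoc_of_le (by linarith : -R ≤ R)]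
        exact ((hetc.mono (prod_mono_right (subset_univ _))).integrableOn_compact
          (isCompact_Icc.prod (isCompact_Icc (a := -R) (b := R)))).mono_set
          (prod_mono Ioc_subset_Icc_self Ioc_subset_Icc_self)
    have hmono : (∫ τ in (0:ℝ)..t, ∫ ξ in (-R)..R, et τ ξ) ≤
        ∫ τ in (0:ℝ)..t, (2 * ε - ∫ ξ in (-R)..R, Q τ ξ) := by
      refine intervalIntegral.integral_mono_on ht
        (intervalIntegrable_box_of_strip ht hetc (-R) R)
        (intervalIntegrable_const.sub (intervalIntegrable_box_of_strip ht hQ (-R) R))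
        fun τ hτ => ?_
      have hQi := (continuous_section_of_strip hQ hτ).intervalIntegrable (μ := volume) (-R) R
      have hBi := (hBc τ hτ).intervalIntegrable (μ := volume) (-R) R
      have hstep : (∫ ξ in (-R)..R, et τ ξ) ≤ ∫ ξ in (-R)..R, (Bx τ ξ - Q τ ξ) :=
        intervalIntegral.integral_mono_on (by linarith)
          ((continuous_section_of_strip hetc hτ).intervalIntegrable _ _) (hBi.sub hQi)
          fun ξ _ => hle τ hτ ξ
      rw [intervalIntegral.integral_sub hBi hQi,
        intervalIntegral.integral_eq_sub_of_hasDerivAt (fun ξ _ => hB τ hτ ξ) hBi] at hstep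
      have hb1 := (abs_lt.1 (hR₀ τ hτ R (hR.trans (le_abs_self R)))).2
      have hb2 := (abs_lt.1 (hR₀ τ hτ (-R) (by rw [abs_neg]; exact hR.trans (le_abs_self R)))).1
      linarith
    rw [intervalIntegral.integral_sub intervalIntegrable_const
      (intervalIntegrable_box_of_strip ht hQ (-R) R), intervalIntegral.integral_const,
      smul_eq_mul, sub_zero] at hmono
    linarith
  refine le_of_forall_pos_le_add fun ε hε => ?_
  have hε' : 0 < ε / (2 * (t + 1)) := by positivity
  have hfin := le_of_tendsto_of_tendsto ((hlim t h1).add hI)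
    ((hlim 0 h0).add tendsto_const_nhds) (hbox _ hε')
  have : t * (2 * (ε / (2 * (t + 1)))) ≤ ε := by
    have h2 : t * (2 * (ε / (2 * (t + 1)))) = t / (t + 1) * ε := by field_simp
    rw [h2]
    exact mul_le_of_le_one_left hε.le (div_le_one_of_le₀ (by linarith) (by linarith))
  linarith

/-- One-dimensional Sobolev inequality. -/
lemma sq_le_integral_sq_add {u u' : ℝ → ℝ} (hu : ∀ x, HasDerivAt u (u' x) x)
    (hu'c : Continuous u') (h0 : Integrable fun x => u x ^ 2)
    (h1 : Integrable fun x => u' x ^ 2) (hlim : Tendsto u atBot (𝓝 0)) (x : ℝ) :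
    u x ^ 2 ≤ (∫ y, u y ^ 2) + ∫ y, u' y ^ 2 := by
  have huc : Continuous u := continuous_iff_continuousAt.2 fun x => (hu x).continuousAt
  have hder : ∀ y, HasDerivAt (fun y => u y ^ 2) (2 * u y * u' y) y := fun y => by
    simpa using (hu y).fun_pow 2
  have hle : ∀ y, ‖2 * u y * u' y‖ ≤ u y ^ 2 + u' y ^ 2 := fun y => by
    rw [Real.norm_eq_abs, abs_le]
    constructor <;> nlinarith [sq_nonneg (u y + u' y), sq_nonneg (u y - u' y)]
  have hint : Integrable fun y => 2 * u y * u' y :=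
    (h0.add h1).mono' (by fun_prop) (ae_of_all _ hle)
  have hftc := integral_Iic_of_hasDerivAt_of_tendsto' (a := x) (m := 0)
    (fun y _ => hder y) hint.integrableOn (by simpa using hlim.pow 2)
  rw [sub_zero] at hftc
  rw [← hftc, ← integral_add h0 h1]
  calc (∫ y in Iic x, 2 * u y * u' y) ≤ ∫ y in Iic x, (u y ^ 2 + u' y ^ 2) :=
        setIntegral_mono hint.integrableOn (h0.fun_add h1).integrableOn
          fun y => (le_abs_self _).trans (hle y)
    _ ≤ ∫ y, (u y ^ 2 + u' y ^ 2) :=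
        setIntegral_le_integral (h0.fun_add h1) (ae_of_all _ fun y => by positivity)

/-- Uniform first- and second-order Taylor bounds on a compact interval of `(0,∞)`. -/
lemma exists_taylor_bound {f : ℝ → ℝ} (hf : ContDiffOn ℝ 2 f (Ioi 0)) {a b : ℝ} (ha : 0 < a) :
    ∃ M > 0, ∀ x ∈ Icc a b, ∀ y ∈ Icc a b,
      |f y - f x| ≤ M * |y - x| ∧ |f y - f x - deriv f x * (y - x)| ≤ M * (y - x) ^ 2 := by
  have hsub : Icc a b ⊆ Ioi 0 := fun x hx => ha.trans_le hx.1
  have hd1 : ContDiffOn ℝ 1 (deriv f) (Ioi 0) := hf.deriv_of_isOpen isOpen_Ioi (by norm_num)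
  have hd2 : ContDiffOn ℝ 0 (deriv (deriv f)) (Ioi 0) :=
    hd1.deriv_of_isOpen isOpen_Ioi (by norm_num)
  obtain ⟨M₁, hM₁⟩ := isCompact_Icc.exists_bound_of_continuousOn (hd1.continuousOn.mono hsub)
  obtain ⟨M₂, hM₂⟩ := isCompact_Icc.exists_bound_of_continuousOn (hd2.continuousOn.mono hsub)
  have hfd : ∀ x ∈ Icc a b, DifferentiableAt ℝ f x := fun x hx =>
    (hf.differentiableOn (by norm_num)).differentiableAt (isOpen_Ioi.mem_nhds (hsub hx))
  have hfdd : ∀ x ∈ Icc a b, DifferentiableAt ℝ (deriv f) x := fun x hx =>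
    (hd1.differentiableOn (by norm_num)).differentiableAt (isOpen_Ioi.mem_nhds (hsub hx))
  refine ⟨max 1 (max M₁ M₂), by positivity, fun x hx y hy => ⟨?_, ?_⟩⟩
  · have := (convex_Icc a b).norm_image_sub_le_of_norm_deriv_le hfd hM₁ hx hy
    exact this.trans (by rw [Real.norm_eq_abs]; gcongr; simp)
  · have hseg : uIcc x y ⊆ Icc a b := (ordConnected_Icc).uIcc_subset hx hy
    have hder : ∀ z ∈ uIcc x y,
        HasDerivAt (fun z => f z - deriv f x * z) (deriv f z - deriv f x) z := fun z hz => by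
      simpa using (hfd z (hseg hz)).hasDerivAt.fun_sub ((hasDerivAt_id z).const_mul (deriv f x))
    have hb : ∀ z ∈ uIcc x y, ‖deriv f z - deriv f x‖ ≤ max 1 (max M₁ M₂) * |y - x| := by
      intro z hz
      refine ((convex_Icc a b).norm_image_sub_le_of_norm_deriv_le hfdd hM₂ hx (hseg hz)).trans ?_
      rw [Real.norm_eq_abs]
      have := abs_sub_left_of_mem_uIcc hz
      gcongr
      simp
    have := (convex_uIcc x y).norm_image_sub_le_of_norm_hasDerivWithin_le
      (fun z hz => (hder z hz).hasDerivWithinAt) hb left_mem_uIcc right_mem_uIcc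
    rw [Real.norm_eq_abs, Real.norm_eq_abs, mul_assoc, abs_mul_abs_self] at this
    convert this using 2 <;> ring

lemma box_integral_linear_combination {F₁ F₂ F₃ : ℝ → ℝ → ℝ} {t : ℝ} (ht : 0 ≤ t)
    (h₁ : ContinuousOn (Function.uncurry F₁) (Icc 0 t ×ˢ univ))
    (h₂ : ContinuousOn (Function.uncurry F₂) (Icc 0 t ×ˢ univ))
    (h₃ : ContinuousOn (Function.uncurry F₃) (Icc 0 t ×ˢ univ)) (c₁ c₂ c₃ a b : ℝ) :
    (∫ τ in (0:ℝ)..t, ∫ ξ in a..b, (c₁ * F₁ τ ξ + c₂ * F₂ τ ξ - c₃ * F₃ τ ξ)) =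
      c₁ * (∫ τ in (0:ℝ)..t, ∫ ξ in a..b, F₁ τ ξ) + c₂ * (∫ τ in (0:ℝ)..t, ∫ ξ in a..b, F₂ τ ξ)
        - c₃ * ∫ τ in (0:ℝ)..t, ∫ ξ in a..b, F₃ τ ξ := by
  have i₁ := (intervalIntegrable_box_of_strip ht h₁ a b).const_mul c₁
  have i₂ := (intervalIntegrable_box_of_strip ht h₂ a b).const_mul c₂
  have i₃ := (intervalIntegrable_box_of_strip ht h₃ a b).const_mul c₃
  rw [← intervalIntegral.integral_const_mul, ← intervalIntegral.integral_const_mul,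
    ← intervalIntegral.integral_const_mul, ← intervalIntegral.integral_add i₁ i₂,
    ← intervalIntegral.integral_sub (i₁.add i₂) i₃]
  refine intervalIntegral.integral_congr fun τ hτ => ?_
  rw [uIcc_of_le ht] at hτ
  have j₁ := ((continuous_section_of_strip h₁ hτ).intervalIntegrable (μ := volume) a b).const_mul c₁
  have j₂ := ((continuous_section_of_strip h₂ hτ).intervalIntegrable (μ := volume) a b).const_mul c₂
  have j₃ := ((continuous_section_of_strip h₃ hτ).intervalIntegrable (μ := volume) a b).const_mul c₃
  rw [intervalIntegral.integral_sub (j₁.add j₂) j₃, intervalIntegral.integral_add j₁ j₂,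
    intervalIntegral.integral_const_mul, intervalIntegral.integral_const_mul,
    intervalIntegral.integral_const_mul]

/-- The pointwise energy inequality: the equations are multiplied by `φ` and `-ψ / p'(ṽ)` and the
nonlinear terms are absorbed. -/
lemma pointwise_energy_le {φ φx φxx φt ψ ψx ψt P q qx s γ γx G π δ M M₁ W a : ℝ}
    (h1 : φt - s * φx - ψx - γ * φxx - γx * φx = G) (h2 : ψt - s * ψx + P * φx = -π)
    (hq : q * P = 1) (hφ : |φ| ≤ δ) (hψ : |ψ| ≤ δ) (hM : 0 ≤ M) (hM₁ : 0 ≤ M₁)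
    (hG : |G| ≤ M * |φx| * |φxx| + M * φx ^ 2 * M₁) (hπ : |π| ≤ M * φx ^ 2) (hW : |q| ≤ W)
    (ha : a ≤ γ) (hδ : M * (1 + M₁ + W) * δ ≤ a / 2) :
    φ * φt - q * ψ * ψt ≤
      (s * φ * φx + (φx * ψ + φ * ψx) + ((γx * φ + γ * φx) * φx + γ * φ * φxx)
        - s / 2 * (qx * ψ ^ 2 + q * (2 * ψ * ψx)))
      - (a / 2 * φx ^ 2 + -s / 2 * (qx * ψ ^ 2) - M * (1 + M₁ + W) * δ * φxx ^ 2) := by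
  have hδ0 : 0 ≤ δ := (abs_nonneg _).trans hφ
  have hW0 : 0 ≤ W := (abs_nonneg _).trans hW
  have hφG : φ * G ≤ δ * (M * (φx ^ 2 + φxx ^ 2) + M * φx ^ 2 * M₁) := by
    refine (le_abs_self _).trans ?_
    rw [abs_mul]
    refine mul_le_mul hφ (hG.trans ?_) (abs_nonneg _) hδ0
    have : |φx| * |φxx| ≤ φx ^ 2 + φxx ^ 2 := by
      rw [← sq_abs φx, ← sq_abs φxx]
      nlinarith [sq_nonneg (|φx| - |φxx|), sq_nonneg (|φx|), sq_nonneg (|φxx|)]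
    nlinarith [mul_le_mul_of_nonneg_left this hM]
  have hψπ : q * ψ * π ≤ W * δ * (M * φx ^ 2) := by
    refine (le_abs_self _).trans ?_
    rw [abs_mul, abs_mul]
    gcongr
  have hγ : a * φx ^ 2 ≤ γ * φx ^ 2 := by gcongr
  have hφt : φt = s * φx + ψx + γ * φxx + γx * φx + G := by linarith
  have hψt : ψt = s * ψx - P * φx - π := by linarith
  have key : φ * φt - q * ψ * ψt = (s * φ * φx + (φx * ψ + φ * ψx)
      + ((γx * φ + γ * φx) * φx + γ * φ * φxx) - s / 2 * (qx * ψ ^ 2 + q * (2 * ψ * ψx)))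
      - (γ * φx ^ 2 + -s / 2 * (qx * ψ ^ 2)) + φ * G + q * ψ * π := by
    rw [hφt, hψt]
    linear_combination (φx * ψ) * hq
  have hφxx : 0 ≤ M * (M₁ + W) * δ * φxx ^ 2 := by positivity
  have hφx := mul_le_mul_of_nonneg_right hδ (sq_nonneg φx)
  rw [key]
  linarith

lemma IsClassicalSolution.mono {p g tv : ℝ → ℝ} {s T t : ℝ} {Φ Ψ : ℝ → ℝ → ℝ}
    (h : IsClassicalSolution p g tv s T Φ Ψ) (htT : t ≤ T) :
    IsClassicalSolution p g tv s t Φ Ψ := by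
  have hsub : Icc 0 t ⊆ Icc 0 T := Icc_subset_Icc_right htT
  have hprod : Icc 0 t ×ˢ (univ : Set ℝ) ⊆ Icc 0 T ×ˢ univ := prod_mono_left hsub
  exact
    { regΦ := fun τ hτ => h.regΦ τ (hsub hτ)
      regΨ := fun τ hτ => h.regΨ τ (hsub hτ)
      tdiffΦ := fun j hj τ hτ => h.tdiffΦ j hj τ (hsub hτ)
      tdiffΨ := fun j hj τ hτ => h.tdiffΨ j hj τ (hsub hτ)
      mixContΦ := fun j hj => (h.mixContΦ j hj).mono hprod
      mixContΨ := fun j hj => (h.mixContΨ j hj).mono hprod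
      spContΦ := fun j hj => (h.spContΦ j hj).mono hprod
      spContΨ := fun j hj => (h.spContΨ j hj).mono hprod
      eq1 := fun τ hτ => h.eq1 τ (hsub hτ)
      eq2 := fun τ hτ => h.eq2 τ (hsub hτ)
      sqIntΦ := fun j hj τ hτ => h.sqIntΦ j hj τ (hsub hτ)
      sqIntΨ := fun j hj τ hτ => h.sqIntΨ j hj τ (hsub hτ)
      l2ContΦ := fun j hj => (h.l2ContΦ j hj).mono hsub
      l2ContΨ := fun j hj => (h.l2ContΨ j hj).mono hsub
      decayΦ := fun j hj ε hε => (h.decayΦ j hj ε hε).imp fun _ hR τ hτ => hR τ (hsub hτ)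
      decayΨ := fun j hj ε hε => (h.decayΨ j hj ε hε).imp fun _ hR τ hτ => hR τ (hsub hτ) }

lemma L2sq_nonneg (w : ℝ → ℝ) : 0 ≤ L2sq w := integral_nonneg fun _ => sq_nonneg _

lemma HkSq_nonneg (k : ℕ) (w : ℝ → ℝ) : 0 ≤ HkSq k w :=
  Finset.sum_nonneg fun _ _ => L2sq_nonneg _

lemma hasDerivAt_iteratedDeriv {w : ℝ → ℝ} {n : ℕ} (hw : ContDiff ℝ n w) {j : ℕ} (hj : j < n)
    (x : ℝ) : HasDerivAt (iteratedDeriv j w) (iteratedDeriv (j + 1) w x) x := by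
  rw [iteratedDeriv_succ]
  exact (hw.differentiable_iteratedDeriv j (by exact_mod_cast hj) x).hasDerivAt

/-- Sup-norm bound for a function of class `H³` and its derivatives up to order two. -/
lemma abs_iteratedDeriv_le_of_HkSq {w : ℝ → ℝ} (hw : ContDiff ℝ 4 w)
    (hint : ∀ j ≤ 4, Integrable fun x => iteratedDeriv j w x ^ 2)
    (hdecay : ∀ j ≤ 3, ∀ ε > (0:ℝ), ∃ R : ℝ, ∀ ξ : ℝ, R ≤ |ξ| → |iteratedDeriv j w ξ| < ε)
    {δ : ℝ} (hδ0 : 0 ≤ δ) (hδ : HkSq 3 w ≤ δ ^ 2) {j : ℕ} (hj : j ≤ 2) (x : ℝ) :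
    |iteratedDeriv j w x| ≤ δ := by
  have hlim : Tendsto (iteratedDeriv j w) atBot (𝓝 0) := by
    refine Metric.tendsto_nhds.2 fun ε hε => ?_
    obtain ⟨R, hR⟩ := hdecay j (by omega) ε hε
    filter_upwards [tendsto_abs_atBot_atTop.eventually_ge_atTop R] with ξ hξ
    simpa using hR ξ hξ
  have hsob := sq_le_integral_sq_add (hasDerivAt_iteratedDeriv (n := 4) (j := j) hw (by omega))
    (hw.continuous_iteratedDeriv (j + 1) (by exact_mod_cast (by omega : j + 1 ≤ 4)))
    (hint j (by omega)) (hint (j + 1) (by omega)) hlim x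
  have hsum : L2sq (iteratedDeriv j w) + L2sq (iteratedDeriv (j + 1) w) ≤ HkSq 3 w := by
    have := Finset.sum_le_sum_of_subset_of_nonneg
      (f := fun j => L2sq (iteratedDeriv j w)) (s := {j, j + 1}) (t := Finset.range (3 + 1))
      (by intro i hi; simp at hi ⊢; omega) fun _ _ _ => L2sq_nonneg _
    rwa [Finset.sum_pair (by omega)] at this
  exact abs_le_of_sq_le_sq (hsob.trans (hsum.trans hδ)) hδ0

/-- The weighted energy inequality for a classical solution, given bounds on the coefficients. -/
lemma IsClassicalSolution.weighted_energy_le {p g tv : ℝ → ℝ} {s t : ℝ} {Φ Ψ : ℝ → ℝ → ℝ}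
    (hsol : IsClassicalSolution p g tv s t Φ Ψ) (ht : 0 ≤ t) {δ δ₀ M M₁ W N a A : ℝ}
    (hδ : ∀ τ ∈ Icc (0:ℝ) t, Real.sqrt (pairHkSq 3 (Φ τ) (Ψ τ)) ≤ δ) (hδδ₀ : δ ≤ δ₀)
    (hpne : ∀ ξ, deriv p (tv ξ) ≠ 0)
    (hq : ContDiff ℝ 1 fun ξ => 1 / deriv p (tv ξ))
    (hγ : ContDiff ℝ 1 fun ξ => deriv g (tv ξ))
    (hγd : ∀ ξ, HasDerivAt (fun ξ => deriv g (tv ξ)) (deriv (deriv g) (tv ξ) * deriv tv ξ) ξ)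
    (hqW : ∀ ξ, |1 / deriv p (tv ξ)| ≤ W)
    (hqx0 : ∀ ξ, 0 ≤ deriv (fun y => 1 / deriv p (tv y)) ξ)
    (hqxN : ∀ ξ, deriv (fun y => 1 / deriv p (tv y)) ξ ≤ N)
    (ha : ∀ ξ, a ≤ deriv g (tv ξ)) (hA : ∀ ξ, |deriv g (tv ξ)| ≤ A)
    (hM : 0 ≤ M) (hM₁ : ∀ ξ, |deriv tv ξ| ≤ M₁)
    (hp2 : ∀ ξ h, |h| ≤ δ₀ → |p (tv ξ + h) - p (tv ξ) - deriv p (tv ξ) * h| ≤ M * h ^ 2)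
    (hg1 : ∀ ξ h, |h| ≤ δ₀ → |deriv g (tv ξ + h) - deriv g (tv ξ)| ≤ M * |h|)
    (hg2 : ∀ ξ h, |h| ≤ δ₀ →
      |deriv g (tv ξ + h) - deriv g (tv ξ) - deriv (deriv g) (tv ξ) * h| ≤ M * h ^ 2)
    (hsmall : M * (1 + M₁ + W) * δ₀ ≤ a / 2) :
    (∫ ξ, ((Φ t ξ) ^ 2 - 1 / deriv p (tv ξ) * (Ψ t ξ) ^ 2) / 2)
      + (a / 2 * (∫ τ in (0:ℝ)..t, ∫ ξ : ℝ, (deriv (Φ τ) ξ) ^ 2)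
        + -s / 2 * (∫ τ in (0:ℝ)..t, ∫ ξ : ℝ,
            deriv (fun y => 1 / deriv p (tv y)) ξ * (Ψ τ ξ) ^ 2)
        - M * (1 + M₁ + W) * δ * (∫ τ in (0:ℝ)..t, ∫ ξ : ℝ, (iteratedDeriv 2 (Φ τ) ξ) ^ 2))
      ≤ ∫ ξ, ((Φ 0 ξ) ^ 2 - 1 / deriv p (tv ξ) * (Ψ 0 ξ) ^ 2) / 2 := by
  set q : ℝ → ℝ := fun y => 1 / deriv p (tv y)
  set γ : ℝ → ℝ := fun ξ => deriv g (tv ξ)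
  have hM₁0 : 0 ≤ M₁ := (abs_nonneg _).trans (hM₁ 0)
  have hW0 : 0 ≤ W := (abs_nonneg _).trans (hqW 0)
  have hA0 : 0 ≤ A := (abs_nonneg _).trans (hA 0)
  have hδ0 : 0 ≤ δ := (Real.sqrt_nonneg _).trans (hδ 0 ⟨le_rfl, ht⟩)
  have hpair : ∀ τ ∈ Icc (0:ℝ) t, pairHkSq 3 (Φ τ) (Ψ τ) ≤ δ ^ 2 := fun τ hτ =>
    (Real.sqrt_le_left hδ0).1 (hδ τ hτ)
  have supΦ : ∀ τ ∈ Icc (0:ℝ) t, ∀ j ≤ 2, ∀ ξ, |iteratedDeriv j (Φ τ) ξ| ≤ δ :=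
    fun τ hτ j hj => abs_iteratedDeriv_le_of_HkSq (hsol.regΦ τ hτ)
      (fun j hj => hsol.sqIntΦ j hj τ hτ)
      (fun j hj ε hε => (hsol.decayΦ j hj ε hε).imp fun _ hR => hR τ hτ) hδ0
      ((le_add_of_nonneg_right (HkSq_nonneg _ _)).trans (hpair τ hτ)) hj
  have supΨ : ∀ τ ∈ Icc (0:ℝ) t, ∀ j ≤ 2, ∀ ξ, |iteratedDeriv j (Ψ τ) ξ| ≤ δ :=
    fun τ hτ j hj => abs_iteratedDeriv_le_of_HkSq (hsol.regΨ τ hτ)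
      (fun j hj => hsol.sqIntΨ j hj τ hτ)
      (fun j hj ε hε => (hsol.decayΨ j hj ε hε).imp fun _ hR => hR τ hτ) hδ0
      ((le_add_of_nonneg_left (HkSq_nonneg _ _)).trans (hpair τ hτ)) hj
  have cΦ := hsol.spContΦ 0 (by norm_num)
  have cΨ := hsol.spContΨ 0 (by norm_num)
  have cΦx := hsol.spContΦ 1 (by norm_num)
  have cΦxx := hsol.spContΦ 2 (by norm_num)
  have cΦt := hsol.mixContΦ 0 (by norm_num)
  have cΨt := hsol.mixContΨ 0 (by norm_num)
  have tΦ := hsol.tdiffΦ 0 (by norm_num)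
  have tΨ := hsol.tdiffΨ 0 (by norm_num)
  have l2Ψ := hsol.l2ContΨ 0 (by norm_num)
  have l2Φx := hsol.l2ContΦ 1 (by norm_num)
  have l2Φxx := hsol.l2ContΦ 2 (by norm_num)
  have iΦ := hsol.sqIntΦ 0 (by norm_num)
  have iΨ := hsol.sqIntΨ 0 (by norm_num)
  have iΦx := hsol.sqIntΦ 1 (by norm_num)
  have iΦxx := hsol.sqIntΦ 2 (by norm_num)
  have dΦ := hsol.decayΦ 0 (by norm_num)
  have dΨ := hsol.decayΨ 0 (by norm_num)
  have dΦx := hsol.decayΦ 1 (by norm_num)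
  have xΦ : ∀ τ ∈ Icc 0 t, ∀ ξ, HasDerivAt (Φ τ) (deriv (Φ τ) ξ) ξ := fun τ hτ ξ => by
    simpa using hasDerivAt_iteratedDeriv (n := 4) (hsol.regΦ τ hτ) (j := 0) (by norm_num) ξ
  have xΨ : ∀ τ ∈ Icc 0 t, ∀ ξ, HasDerivAt (Ψ τ) (deriv (Ψ τ) ξ) ξ := fun τ hτ ξ => by
    simpa using hasDerivAt_iteratedDeriv (n := 4) (hsol.regΨ τ hτ) (j := 0) (by norm_num) ξ
  have xΦx : ∀ τ ∈ Icc 0 t, ∀ ξ, HasDerivAt (deriv (Φ τ)) (iteratedDeriv 2 (Φ τ) ξ) ξ :=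
    fun τ hτ ξ => by
      simpa using hasDerivAt_iteratedDeriv (n := 4) (hsol.regΦ τ hτ) (j := 1) (by norm_num) ξ
  simp only [iteratedDeriv_zero, iteratedDeriv_one, L2sq] at *
  have hqd : ∀ ξ, HasDerivAt q (deriv q ξ) ξ := fun ξ =>
    (hq.differentiable (by norm_num) ξ).hasDerivAt
  have hqc : Continuous q := hq.continuous
  have hqxc : Continuous (deriv q) := hq.continuous_deriv le_rfl
  have hγc : Continuous γ := hγ.continuous
  have hγxc : Continuous fun ξ => deriv (deriv g) (tv ξ) * deriv tv ξ := by
    have h : deriv γ = fun ξ => deriv (deriv g) (tv ξ) * deriv tv ξ :=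
      funext fun ξ => (hγd ξ).deriv
    rw [← h]
    exact hγ.continuous_deriv le_rfl
  have cont_sq : ∀ {F : ℝ → ℝ → ℝ},
      ContinuousOn (fun x : ℝ × ℝ => F x.1 x.2) (Icc 0 t ×ˢ univ) →
      ContinuousOn (Function.uncurry fun τ ξ => F τ ξ ^ 2) (Icc 0 t ×ˢ univ) :=
    fun h => h.pow 2
  have cQ₁ := cont_sq (F := fun τ => deriv (Φ τ)) cΦx
  have cQ₃ := cont_sq (F := fun τ => iteratedDeriv 2 (Φ τ)) cΦxx
  have cQ₂ : ContinuousOn (Function.uncurry fun τ ξ => deriv q ξ * Ψ τ ξ ^ 2)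
      (Icc 0 t ×ˢ univ) :=
    (hqxc.comp continuous_snd).continuousOn.mul (cont_sq cΨ)
  have hI := (((tendsto_box_integral (M := 1) ht cQ₁ (fun _ _ _ => sq_nonneg _)
      (fun _ _ _ => (one_mul _).ge) iΦx l2Φx).const_mul (a / 2)).add
    ((tendsto_box_integral (M := N) ht cQ₂ (fun τ _ ξ => mul_nonneg (hqx0 ξ) (sq_nonneg _))
      (fun τ _ ξ => mul_le_mul_of_nonneg_right (hqxN ξ) (sq_nonneg _)) iΨ l2Ψ).const_mul
        (-s / 2))).sub
    ((tendsto_box_integral (M := 1) ht cQ₃ (fun _ _ _ => sq_nonneg _)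
      (fun _ _ _ => (one_mul _).ge) iΦxx l2Φxx).const_mul (M * (1 + M₁ + W) * δ))
  simp only [← box_integral_linear_combination ht cQ₁ cQ₂ cQ₃] at hI
  refine integral_add_le_of_pointwise ht
    (e := fun τ ξ => ((Φ τ ξ) ^ 2 - q ξ * (Ψ τ ξ) ^ 2) / 2)
    (et := fun τ ξ => Φ τ ξ * deriv (fun τ => Φ τ ξ) τ - q ξ * Ψ τ ξ * deriv (fun τ => Ψ τ ξ) τ)
    (B := fun τ ξ => s / 2 * Φ τ ξ ^ 2 + Φ τ ξ * Ψ τ ξ + γ ξ * Φ τ ξ * deriv (Φ τ) ξ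
      - s / 2 * (q ξ * Ψ τ ξ ^ 2))
    (Bx := fun τ ξ => s * Φ τ ξ * deriv (Φ τ) ξ + (deriv (Φ τ) ξ * Ψ τ ξ + Φ τ ξ * deriv (Ψ τ) ξ)
      + ((deriv (deriv g) (tv ξ) * deriv tv ξ * Φ τ ξ + γ ξ * deriv (Φ τ) ξ) * deriv (Φ τ) ξ
        + γ ξ * Φ τ ξ * iteratedDeriv 2 (Φ τ) ξ)
      - s / 2 * (deriv q ξ * Ψ τ ξ ^ 2 + q ξ * (2 * Ψ τ ξ * deriv (Ψ τ) ξ)))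
    ?_ ?_ ?_ ?_ ?_ ?_ ?_ ?_ hI
  · intro τ hτ ξ
    have h := (((tΦ τ hτ ξ).hasDerivAt.fun_pow 2).fun_sub
      (((tΨ τ hτ ξ).hasDerivAt.fun_pow 2).const_mul (q ξ))).div_const 2
    refine h.congr_deriv ?_
    push_cast
    ring
  · exact (cΦ.mul cΦt).sub (((hqc.comp continuous_snd).continuousOn.mul cΨ).mul cΨt)
  · intro τ hτ ξ
    have h := (((((xΦ τ hτ ξ).fun_pow 2).const_mul (s / 2)).fun_add
      ((xΦ τ hτ ξ).fun_mul (xΨ τ hτ ξ))).fun_add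
      (((hγd ξ).fun_mul (xΦ τ hτ ξ)).fun_mul (xΦx τ hτ ξ))).fun_sub
      (((hqd ξ).fun_mul ((xΨ τ hτ ξ).fun_pow 2)).const_mul (s / 2))
    refine h.congr_deriv ?_
    push_cast
    ring
  · intro τ hτ
    have r0 := (hsol.regΦ τ hτ).continuous
    have r1 := (hsol.regΦ τ hτ).continuous_deriv (by norm_num)
    have r2 := (hsol.regΦ τ hτ).continuous_iteratedDeriv 2 (by norm_num)
    have r3 := (hsol.regΨ τ hτ).continuous
    have r4 := (hsol.regΨ τ hτ).continuous_deriv (by norm_num)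
    fun_prop
  · exact ((continuousOn_const.mul cQ₁).add (continuousOn_const.mul cQ₂)).sub
      (continuousOn_const.mul cQ₃)
  · intro τ hτ ξ
    have hφ : |Φ τ ξ| ≤ δ := by simpa using supΦ τ hτ 0 (by norm_num) ξ
    have hψ : |Ψ τ ξ| ≤ δ := by simpa using supΨ τ hτ 0 (by norm_num) ξ
    have hφx : |deriv (Φ τ) ξ| ≤ δ₀ := by
      simpa using (supΦ τ hτ 1 (by norm_num) ξ).trans hδδ₀
    refine pointwise_energy_le (hsol.eq1 τ hτ ξ) (hsol.eq2 τ hτ ξ) (one_div_mul_cancel (hpne ξ))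
      hφ hψ hM hM₁0 ?_ (hp2 ξ _ hφx) (hqW ξ) (ha ξ) (le_trans (by gcongr) hsmall)
    refine (abs_add_le _ _).trans ?_
    rw [abs_mul, abs_mul]
    have := hg1 ξ _ hφx
    have := hg2 ξ _ hφx
    have := hM₁ ξ
    gcongr
  · intro ε hε
    set L : ℝ := |s| / 2 + 1 + A + |s| / 2 * W + 1 with hL
    have hL0 : 0 < L := by positivity
    have hη : 0 < min 1 (ε / L) := by positivity
    obtain ⟨R₁, h₁⟩ := dΦ _ hη
    obtain ⟨R₂, h₂⟩ := dΨ _ hη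
    obtain ⟨R₃, h₃⟩ := dΦx _ hη
    refine ⟨max R₁ (max R₂ R₃), fun τ hτ ξ hξ => ?_⟩
    have b₁ := (h₁ τ hτ ξ ((le_max_left _ _).trans hξ)).le
    have b₂ := (h₂ τ hτ ξ ((le_max_left _ _).trans ((le_max_right _ _).trans hξ))).le
    have b₃ := (h₃ τ hτ ξ ((le_max_right _ _).trans ((le_max_right _ _).trans hξ))).le
    set η := min 1 (ε / L)
    have hη1 : η ≤ 1 := min_le_left _ _
    have hηε : η * L ≤ ε := (le_div_iff₀ hL0).1 (min_le_right _ _)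
    have hqb := hqW ξ
    have hAb := hA ξ
    calc |s / 2 * Φ τ ξ ^ 2 + Φ τ ξ * Ψ τ ξ + γ ξ * Φ τ ξ * deriv (Φ τ) ξ
          - s / 2 * (q ξ * Ψ τ ξ ^ 2)|
        ≤ |s| / 2 * |Φ τ ξ| ^ 2 + |Φ τ ξ| * |Ψ τ ξ| + |γ ξ| * |Φ τ ξ| * |deriv (Φ τ) ξ|
          + |s| / 2 * (|q ξ| * |Ψ τ ξ| ^ 2) := by
          refine (abs_sub _ _).trans (add_le_add ((abs_add_three _ _ _).trans ?_) ?_) <;>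
            simp [abs_mul, abs_div]
      _ ≤ |s| / 2 * η ^ 2 + η * η + A * η * η + |s| / 2 * (W * η ^ 2) := by gcongr
      _ = (L - 1) * η * η := by rw [hL]; ring
      _ ≤ (L - 1) * η * 1 := by
          have : 0 ≤ L - 1 := by rw [hL, add_sub_cancel_right]; positivity
          gcongr
      _ < ε := by linarith
  · intro τ hτ
    refine ((iΦ τ hτ).sub (Integrable.bdd_mul (c := W) (iΨ τ hτ) hqc.aestronglyMeasurable
      (ae_of_all _ hqW))).div_const 2

theorem basic_energy_estimate
    (p : ℝ → ℝ)
    (hp_smooth : ContDiffOn ℝ (⊤ : ℕ∞) p (Set.Ioi 0))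
    (hpd : ∀ v ∈ Set.Ioi (0:ℝ), deriv p v < 0)
    (hpdd : ∀ v ∈ Set.Ioi (0:ℝ), 0 ≤ deriv (deriv p) v)
    (hpdd_ne : ∀ a b : ℝ, 0 < a → a < b → ∃ v ∈ Set.Ioo a b, deriv (deriv p) v ≠ 0)
    (μ : ℝ → ℝ)
    (hmu_smooth : ContDiffOn ℝ (⊤ : ℕ∞) μ (Set.Ioi 0))
    (hmu_pos : ∀ v ∈ Set.Ioi (0:ℝ), 0 < μ v)
    (vp vm s : ℝ)
    (hvp : 0 < vp) (hvpvm : vp < vm)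
    (hs : s = -Real.sqrt (-((p vp - p vm) / (vp - vm))))
    (hsneg : s < 0)
    (g : ℝ → ℝ)
    (hg : ∀ z ∈ Set.Ioi (0:ℝ), HasDerivAt g (μ z / z) z)
    (tv : ℝ → ℝ)
    (htv_smooth : ContDiff ℝ (⊤ : ℕ∞) tv)
    (htv_ode : ∀ ξ : ℝ, deriv tv ξ
        = tv ξ / (-s * μ (tv ξ)) * (s ^ 2 * (tv ξ - vm) + p (tv ξ) - p vm))
    (htv_mem : ∀ ξ : ℝ, tv ξ ∈ Set.Ioo vp vm)
    (htv_dec : ∀ ξ : ℝ, deriv tv ξ < 0)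
    (htv_bot : Filter.Tendsto tv Filter.atBot (nhds vm))
    (htv_top : Filter.Tendsto tv Filter.atTop (nhds vp))
    (htv_bdd : ∀ k : ℕ, ∃ M : ℝ, ∀ ξ : ℝ, |iteratedDeriv k tv ξ| ≤ M)
 :
    ∃ δ₀ > (0:ℝ), ∃ C > (0:ℝ), ∀ T > (0:ℝ), ∀ δ ≤ δ₀, ∀ Φ Ψ : ℝ → ℝ → ℝ,
      IsClassicalSolution p g tv s T Φ Ψ →
      (∀ t ∈ Set.Icc (0:ℝ) T, Real.sqrt (pairHkSq 3 (Φ t) (Ψ t)) ≤ δ) →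
      ∀ t ∈ Set.Icc (0:ℝ) T,
        (∫ ξ : ℝ, ((Φ t ξ) ^ 2 + (Ψ t ξ) ^ 2))
            - s * (∫ τ in (0:ℝ)..t, ∫ ξ : ℝ,
                deriv (fun y => 1 / deriv p (tv y)) ξ * (Ψ τ ξ) ^ 2)
            + (∫ τ in (0:ℝ)..t, ∫ ξ : ℝ, (deriv (Φ τ) ξ) ^ 2)
          ≤ C * pairHkSq 0 (Φ 0) (Ψ 0)
            + C * δ * (∫ τ in (0:ℝ)..t, ∫ ξ : ℝ, (iteratedDeriv 2 (Φ τ) ξ) ^ 2) := by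
  have hI : Icc vp vm ⊆ Ioi (0:ℝ) := fun x hx => hvp.trans_le hx.1
  have hmem : ∀ ξ, tv ξ ∈ Icc vp vm := fun ξ => Ioo_subset_Icc_self (htv_mem ξ)
  have hpos : ∀ ξ, tv ξ ∈ Ioi (0:ℝ) := fun ξ => hI (hmem ξ)
  have hne : (Icc vp vm).Nonempty := nonempty_Icc.2 hvpvm.le
  have htv1 : ContDiff ℝ 1 tv := htv_smooth.of_le (by exact_mod_cast le_top)
  -- smoothness of the coefficients
  have hp1 : ContDiffOn ℝ 2 (deriv p) (Ioi 0) :=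
    hp_smooth.deriv_of_isOpen isOpen_Ioi (by
      norm_num
      exact WithTop.coe_le_coe.2 (le_top : (3 : ℕ∞) ≤ ⊤))
  have hp2 : ContDiffOn ℝ 1 (deriv (deriv p)) (Ioi 0) :=
    hp1.deriv_of_isOpen isOpen_Ioi (by norm_num)
  have hg_eq : ∀ z ∈ Ioi (0:ℝ), deriv g z = μ z / z := fun z hz => (hg z hz).deriv
  have hg1 : ContDiffOn ℝ 2 (deriv g) (Ioi 0) :=
    ((hmu_smooth.div contDiffOn_id fun z hz => ne_of_gt hz).congr hg_eq).of_le
      (WithTop.coe_le_coe.2 (le_top : (2 : ℕ∞) ≤ ⊤))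
  have hpt : ContDiff ℝ 1 fun ξ => deriv p (tv ξ) :=
    contDiffOn_univ.1 ((hp1.of_le (by norm_num)).comp htv1.contDiffOn fun ξ _ => hpos ξ)
  have hγ : ContDiff ℝ 1 fun ξ => deriv g (tv ξ) :=
    contDiffOn_univ.1 ((hg1.of_le (by norm_num)).comp htv1.contDiffOn fun ξ _ => hpos ξ)
  have hpne : ∀ ξ, deriv p (tv ξ) ≠ 0 := fun ξ => (hpd _ (hpos ξ)).ne
  have hq : ContDiff ℝ 1 fun ξ => 1 / deriv p (tv ξ) := contDiff_const.div hpt hpne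
  have htvd : ∀ ξ, HasDerivAt tv (deriv tv ξ) ξ := fun ξ =>
    (htv1.differentiable (by norm_num) ξ).hasDerivAt
  have hγd : ∀ ξ, HasDerivAt (fun ξ => deriv g (tv ξ)) (deriv (deriv g) (tv ξ) * deriv tv ξ) ξ :=
    fun ξ => HasDerivAt.comp ξ ((hg1.differentiableOn (by norm_num)).differentiableAt
      (isOpen_Ioi.mem_nhds (hpos ξ))).hasDerivAt (htvd ξ)
  have hqd : ∀ ξ, deriv (fun y => 1 / deriv p (tv y)) ξ =
      deriv (deriv p) (tv ξ) * (-deriv tv ξ) * (1 / deriv p (tv ξ)) ^ 2 := fun ξ => by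
    have h := HasDerivAt.comp ξ ((hp1.differentiableOn (by norm_num)).differentiableAt
      (isOpen_Ioi.mem_nhds (hpos ξ))).hasDerivAt (htvd ξ)
    have hinv := (h.fun_inv (hpne ξ)).deriv
    simp only [Function.comp_apply] at hinv
    simp only [one_div, hinv]
    field_simp
  -- bounds for the coefficients
  obtain ⟨x₀, hx₀, hx₀min⟩ := isCompact_Icc.exists_isMinOn hne (hg1.continuousOn.mono hI)
  obtain ⟨x₁, hx₁, hx₁max⟩ := isCompact_Icc.exists_isMaxOn hne (hp1.continuousOn.mono hI)
  obtain ⟨P, hP⟩ := isCompact_Icc.exists_bound_of_continuousOn (hp1.continuousOn.mono hI)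
  obtain ⟨P₂, hP₂⟩ := isCompact_Icc.exists_bound_of_continuousOn (hp2.continuousOn.mono hI)
  obtain ⟨A, hA⟩ := isCompact_Icc.exists_bound_of_continuousOn (hg1.continuousOn.mono hI)
  obtain ⟨M₁, hM₁⟩ := htv_bdd 1
  simp only [iteratedDeriv_one] at hM₁
  have hM₁0 : 0 ≤ M₁ := (abs_nonneg _).trans (hM₁ 0)
  obtain ⟨Mp, hMp0, hMp⟩ := exists_taylor_bound (f := p) (a := vp / 2) (b := vm + vp / 2)
    (hp_smooth.of_le (WithTop.coe_le_coe.2 (le_top : (2 : ℕ∞) ≤ ⊤))) (half_pos hvp)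
  obtain ⟨Mg, hMg0, hMg⟩ := exists_taylor_bound (f := deriv g) (a := vp / 2) (b := vm + vp / 2)
    hg1 (half_pos hvp)
  set a : ℝ := deriv g x₀ with hadef
  have ha0 : 0 < a := by
    rw [hadef, hg_eq _ (hI hx₀)]
    exact div_pos (hmu_pos _ (hI hx₀)) (hI hx₀)
  have hP0 : 0 < P := (norm_pos_iff.2 (hpne 0)).trans_le (hP _ (hmem 0))
  have hx₁neg : 0 < -deriv p x₁ := neg_pos.2 (hpd _ (hI hx₁))
  set W : ℝ := 1 / (-deriv p x₁)
  have hW0 : 0 < W := one_div_pos.2 hx₁neg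
  have hqneg : ∀ ξ, 1 / deriv p (tv ξ) < 0 := fun ξ => one_div_neg.2 (hpd _ (hpos ξ))
  have hqW : ∀ ξ, -(1 / deriv p (tv ξ)) ≤ W := fun ξ => by
    rw [← one_div_neg_eq_neg_one_div]
    exact one_div_le_one_div_of_le hx₁neg (neg_le_neg (hx₁max (hmem ξ)))
  have hqP : ∀ ξ, 1 / P ≤ -(1 / deriv p (tv ξ)) := fun ξ => by
    rw [← one_div_neg_eq_neg_one_div]
    exact one_div_le_one_div_of_le (neg_pos.2 (hpd _ (hpos ξ)))
      ((neg_le_abs _).trans (hP _ (hmem ξ)))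
  have hqabs : ∀ ξ, |1 / deriv p (tv ξ)| ≤ W := fun ξ => by
    rw [abs_of_neg (hqneg ξ)]
    exact hqW ξ
  have hqx0 : ∀ ξ, 0 ≤ deriv (fun y => 1 / deriv p (tv y)) ξ := fun ξ => by
    rw [hqd]
    exact mul_nonneg (mul_nonneg (hpdd _ (hpos ξ)) (neg_nonneg.2 (htv_dec ξ).le)) (sq_nonneg _)
  have hqxN : ∀ ξ, deriv (fun y => 1 / deriv p (tv y)) ξ ≤ P₂ * M₁ * W ^ 2 := fun ξ => by
    rw [hqd, ← sq_abs (1 / deriv p (tv ξ))]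
    have h₁ : deriv (deriv p) (tv ξ) ≤ P₂ := (le_abs_self _).trans (hP₂ _ (hmem ξ))
    have h₂ : -deriv tv ξ ≤ M₁ := (neg_le_abs _).trans (hM₁ ξ)
    have h₃ := hpdd _ (hpos ξ)
    have h₄ : 0 ≤ -deriv tv ξ := neg_nonneg.2 (htv_dec ξ).le
    have h₅ : 0 ≤ P₂ := h₃.trans h₁
    have h₆ := hqabs ξ
    gcongr
  set M : ℝ := Mp + Mg
  have hM0 : 0 < M := add_pos hMp0 hMg0
  set K : ℝ := M * (1 + M₁ + W)
  have hK0 : 0 < K := by positivity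
  set δ₀ : ℝ := min (vp / 2) (a / (2 * K))
  have hδ₀ : 0 < δ₀ := by positivity
  have hsmall : K * δ₀ ≤ a / 2 := by
    calc K * δ₀ ≤ K * (a / (2 * K)) := by gcongr; exact min_le_right _ _
      _ = a / 2 := by field_simp
  have hJ : ∀ ξ h, |h| ≤ δ₀ → tv ξ ∈ Icc (vp / 2) (vm + vp / 2) ∧
      tv ξ + h ∈ Icc (vp / 2) (vm + vp / 2) := fun ξ h hh => by
    have h₁ := abs_le.1 (hh.trans (min_le_left _ _))
    have h₂ := hmem ξ
    constructor <;> constructor <;> linarith [h₁.1, h₁.2, h₂.1, h₂.2]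
  have tp : ∀ ξ h, |h| ≤ δ₀ → |p (tv ξ + h) - p (tv ξ) - deriv p (tv ξ) * h| ≤ M * h ^ 2 :=
    fun ξ h hh => by
      have := (hMp _ (hJ ξ h hh).1 _ (hJ ξ h hh).2).2
      rw [add_sub_cancel_left] at this
      exact this.trans (by gcongr; linarith)
  have tg1 : ∀ ξ h, |h| ≤ δ₀ → |deriv g (tv ξ + h) - deriv g (tv ξ)| ≤ M * |h| :=
    fun ξ h hh => by
      have := (hMg _ (hJ ξ h hh).1 _ (hJ ξ h hh).2).1
      rw [add_sub_cancel_left] at this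
      exact this.trans (by gcongr; linarith)
  have tg2 : ∀ ξ h, |h| ≤ δ₀ →
      |deriv g (tv ξ + h) - deriv g (tv ξ) - deriv (deriv g) (tv ξ) * h| ≤ M * h ^ 2 :=
    fun ξ h hh => by
      have := (hMg _ (hJ ξ h hh).1 _ (hJ ξ h hh).2).2
      rw [add_sub_cancel_left] at this
      exact this.trans (by gcongr; linarith)
  -- the estimate
  set m : ℝ := min 1 (min (1 / P) a) / 2 with hmdef
  have hm0 : 0 < m := by positivity
  have hm1 : m ≤ 1 / 2 := by rw [hmdef]; gcongr; exact min_le_left _ _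
  have hmP : m ≤ 1 / P / 2 := by
    rw [hmdef]; gcongr; exact (min_le_right _ _).trans (min_le_left _ _)
  have hma : m ≤ a / 2 := by
    rw [hmdef]; gcongr; exact (min_le_right _ _).trans (min_le_right _ _)
  refine ⟨δ₀, hδ₀, ((1 + W) / 2 + K) / m, by positivity, ?_⟩
  intro T hT δ hδ Φ Ψ hsol hsmallness t ht
  have hsol_t := hsol.mono ht.2
  have hδ0 : 0 ≤ δ := (Real.sqrt_nonneg _).trans (hsmallness t ht)
  have henergy := hsol_t.weighted_energy_le ht.1
    (fun τ hτ => hsmallness τ ⟨hτ.1, hτ.2.trans ht.2⟩) hδ hpne hq hγ hγd hqabs hqx0 hqxN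
    (fun ξ => hx₀min (hmem ξ)) (fun ξ => hA _ (hmem ξ)) hM0.le hM₁ tp tg1 tg2 hsmall
  have h0T : (0:ℝ) ∈ Icc 0 T := ⟨le_rfl, hT.le⟩
  have hΦi : ∀ τ ∈ Icc 0 T, Integrable fun ξ => Φ τ ξ ^ 2 := fun τ hτ => by
    simpa using hsol.sqIntΦ 0 (by norm_num) τ hτ
  have hΨi : ∀ τ ∈ Icc 0 T, Integrable fun ξ => Ψ τ ξ ^ 2 := fun τ hτ => by
    simpa using hsol.sqIntΨ 0 (by norm_num) τ hτ
  have hei : ∀ τ ∈ Icc 0 T,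
      Integrable fun ξ => (Φ τ ξ ^ 2 - 1 / deriv p (tv ξ) * Ψ τ ξ ^ 2) / 2 := fun τ hτ =>
    ((hΦi τ hτ).sub (Integrable.bdd_mul (c := W) (hΨi τ hτ) hq.continuous.aestronglyMeasurable
      (ae_of_all _ hqabs))).div_const 2
  have hlow : m * (∫ ξ, (Φ t ξ ^ 2 + Ψ t ξ ^ 2)) ≤
      ∫ ξ, (Φ t ξ ^ 2 - 1 / deriv p (tv ξ) * Ψ t ξ ^ 2) / 2 := by
    rw [← integral_const_mul]
    refine integral_mono (((hΦi t ht).fun_add (hΨi t ht)).const_mul m) (hei t ht) fun ξ => ?_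
    have h₁ := mul_le_mul_of_nonneg_right hm1 (sq_nonneg (Φ t ξ))
    have h₂ := mul_le_mul_of_nonneg_right (hmP.trans (div_le_div_of_nonneg_right (hqP ξ)
      zero_le_two)) (sq_nonneg (Ψ t ξ))
    simp only
    linarith
  have hpair : pairHkSq 0 (Φ 0) (Ψ 0) = ∫ ξ, (Φ 0 ξ ^ 2 + Ψ 0 ξ ^ 2) := by
    rw [integral_add (hΦi 0 h0T) (hΨi 0 h0T)]
    simp [pairHkSq, HkSq, L2sq]
  have hup : (∫ ξ, (Φ 0 ξ ^ 2 - 1 / deriv p (tv ξ) * Ψ 0 ξ ^ 2) / 2) ≤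
      (1 + W) / 2 * pairHkSq 0 (Φ 0) (Ψ 0) := by
    rw [hpair, ← integral_const_mul]
    refine integral_mono (hei 0 h0T) (((hΦi 0 h0T).fun_add (hΨi 0 h0T)).const_mul _) fun ξ => ?_
    have h₁ := mul_le_mul_of_nonneg_right (hqW ξ) (sq_nonneg (Ψ 0 ξ))
    have h₂ := mul_nonneg hW0.le (sq_nonneg (Φ 0 ξ))
    have h₃ := sq_nonneg (Ψ 0 ξ)
    simp only
    linarith
  have hpair0 : 0 ≤ pairHkSq 0 (Φ 0) (Ψ 0) := add_nonneg (HkSq_nonneg _ _) (HkSq_nonneg _ _)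
  have hY : 0 ≤ ∫ τ in (0:ℝ)..t, ∫ ξ : ℝ,
      deriv (fun y => 1 / deriv p (tv y)) ξ * (Ψ τ ξ) ^ 2 :=
    intervalIntegral.integral_nonneg ht.1 fun τ _ => integral_nonneg fun ξ =>
      mul_nonneg (hqx0 ξ) (sq_nonneg _)
  have hZ : 0 ≤ ∫ τ in (0:ℝ)..t, ∫ ξ : ℝ, (deriv (Φ τ) ξ) ^ 2 :=
    intervalIntegral.integral_nonneg ht.1 fun τ _ => integral_nonneg fun ξ => sq_nonneg _
  have hV : 0 ≤ ∫ τ in (0:ℝ)..t, ∫ ξ : ℝ, (iteratedDeriv 2 (Φ τ) ξ) ^ 2 :=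
    intervalIntegral.integral_nonneg ht.1 fun τ _ => integral_nonneg fun ξ => sq_nonneg _
  set X := ∫ ξ, (Φ t ξ ^ 2 + Ψ t ξ ^ 2)
  set Y := ∫ τ in (0:ℝ)..t, ∫ ξ : ℝ, deriv (fun y => 1 / deriv p (tv y)) ξ * (Ψ τ ξ) ^ 2
  set Z := ∫ τ in (0:ℝ)..t, ∫ ξ : ℝ, (deriv (Φ τ) ξ) ^ 2
  set V := ∫ τ in (0:ℝ)..t, ∫ ξ : ℝ, (iteratedDeriv 2 (Φ τ) ξ) ^ 2
  have hmZ := mul_le_mul_of_nonneg_right hma hZ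
  have hmY := mul_le_mul_of_nonneg_right hm1 (mul_nonneg (neg_nonneg.2 hsneg.le) hY)
  have hKp := mul_nonneg hK0.le hpair0
  have hWV := mul_nonneg (mul_nonneg (by positivity : 0 ≤ (1 + W) / 2) hδ0) hV
  have hrhs : ((1 + W) / 2 + K) / m * pairHkSq 0 (Φ 0) (Ψ 0) + ((1 + W) / 2 + K) / m * δ * V =
      (((1 + W) / 2 + K) * pairHkSq 0 (Φ 0) (Ψ 0) + ((1 + W) / 2 + K) * δ * V) / m := by
    ring
  rw [hrhs, le_div_iff₀ hm0]
  linarith
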